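/- If a rectifiable space G is Fréchet-Urysohn, then G is strongly Fréchet-Urysohn. -/

import Mathlib

open Filter Topology Set

/-- A topological space `G` is rectifiable if there exist a homeomorphism
`φ : G × G → G × G` and an element `e ∈ G` such that `π₁ ∘ φ = π₁` and
`φ (x, x) = (x, e)` for every `x ∈ G`. -/
def RectifiableSpace (G : Type*) [TopologicalSpace G] : Prop :=
  ∃ (φ : G × G ≃ₜ G × G) (e : G),
    (∀ z : G × G, (φ z).1 = z.1) ∧ ∀ x : G, φ (x, x) = (x, e)

/-- A space `X` is Fréchet–Urysohn if for each subset `A ⊆ X` and each point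
`x ∈ closure A` there exists a sequence of points of `A` converging to `x`. -/
def FrechetUrysohn (X : Type*) [TopologicalSpace X] : Prop :=
  ∀ (A : Set X) (x : X), x ∈ closure A →
    ∃ u : ℕ → X, (∀ n, u n ∈ A) ∧ Tendsto u atTop (𝓝 x)

/-- A space `X` is strongly Fréchet–Urysohn if for every `x ∈ X` and every
sequence `{A n}` of subsets of `X` with `x ∈ ⋂ n, closure (A n)`, there is a
sequence in `X` converging to `x` and intersecting infinitely many members of
the family `{A n}`. -/
def StronglyFrechetUrysohn (X : Type*) [TopologicalSpace X] : Prop :=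
  ∀ (x : X) (A : ℕ → Set X), (∀ n : ℕ, x ∈ closure (A n)) →
    ∃ u : ℕ → X, Tendsto u atTop (𝓝 x) ∧
      {n : ℕ | (Set.range u ∩ A n).Nonempty}.Infinite

/-- A rectifiable space carries continuous operations `p` and `q` such that `p a` and `q a` are
mutually inverse and `p a` sends `a` to a base point `e` not depending on `a`. -/
theorem RectifiableSpace.exists_operations {G : Type*} [TopologicalSpace G]
    (h : RectifiableSpace G) :
    ∃ (p q : G × G → G) (e : G), Continuous p ∧ Continuous q ∧ (∀ a, p (a, a) = e) ∧
      (∀ a b, p (a, q (a, b)) = b) ∧ ∀ a b, q (a, p (a, b)) = b := by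
  obtain ⟨φ, e, h₁, h₂⟩ := h
  have h₃ (z : G × G) : (φ.symm z).1 = z.1 := by
    rw [← h₁ (φ.symm z), φ.apply_symm_apply]
  refine ⟨fun z => (φ z).2, fun z => (φ.symm z).2, e, by fun_prop, by fun_prop,
    fun a => by simp [h₂], fun a b => ?_, fun a b => ?_⟩
  · have : (a, (φ.symm (a, b)).2) = φ.symm (a, b) := Prod.ext (h₃ (a, b)).symm rfl
    simp only [this, φ.apply_symm_apply]
  · have : (a, (φ (a, b)).2) = φ (a, b) := Prod.ext (h₁ (a, b)).symm rfl
    simp only [this, φ.symm_apply_apply]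

/-- If a rectifiable space is Fréchet–Urysohn, then it is strongly Fréchet–Urysohn. -/
theorem rectifiable_frechetUrysohn_stronglyFrechetUrysohn {G : Type*}
    [TopologicalSpace G] [T1Space G] [RegularSpace G]
    (hrec : RectifiableSpace G) (hFU : FrechetUrysohn G) :
    StronglyFrechetUrysohn G := by
  intro x A hA
  by_cases hx : x ∈ closure ({x}ᶜ : Set G)
  swap
  · -- At an isolated point the constant sequence works.
    have hopen : ({x} : Set G) ∈ 𝓝 x := by
      simpa [closure_compl, mem_interior_iff_mem_nhds] using hx
    have hmem (n : ℕ) : x ∈ A n := by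
      obtain ⟨y, rfl, hy⟩ := mem_closure_iff_nhds.1 (hA n) _ hopen
      exact hy
    refine ⟨fun _ => x, tendsto_const_nhds, ?_⟩
    have huniv : {n : ℕ | (Set.range (fun _ : ℕ => x) ∩ A n).Nonempty} = Set.univ :=
      Set.eq_univ_of_forall fun n => ⟨x, ⟨0, rfl⟩, hmem n⟩
    rw [huniv]
    exact Set.infinite_univ
  obtain ⟨p, q, e, hp, hq, hpe, hpq, hqp⟩ := hrec.exists_operations
  have hqe (a : G) : q (a, e) = a := by rw [← hpe a, hqp]
  obtain ⟨s, hs, hsx⟩ := hFU _ x hx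
  choose U V hU hV hxU hsV hUV using fun n => t2_separation (Ne.symm (hs n))
  -- Translate each `A n` to `s n` and cut it down to a neighbourhood of `s n` away from `x`.
  let B : Set G := ⋃ n, V n ∩ (fun a => q (s n, p (x, a))) '' A n
  have hsB (n : ℕ) : s n ∈ closure B := by
    refine closure_mono (subset_iUnion _ n) ((hV n).inter_closure ⟨hsV n, ?_⟩)
    have hf : Continuous fun a => q (s n, p (x, a)) := by fun_prop
    simpa [hpe, hqe] using image_closure_subset_closure_image hf (mem_image_of_mem _ (hA n))
  obtain ⟨y, hyB, hyx⟩ := hFU B x (isClosed_closure.mem_of_tendsto hsx (.of_forall hsB))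
  simp only [B, mem_iUnion] at hyB
  choose N hyV a haA hay using hyB
  have hN : Tendsto N atTop atTop := by
    refine tendsto_atTop.2 fun b => ?_
    have hne : ∀ᶠ k in atTop, ∀ m ∈ Iio b, N k ≠ m := by
      refine (eventually_all_finite (finite_Iio b)).2 fun m _ => ?_
      filter_upwards [hyx.eventually ((hU m).mem_nhds (hxU m))] with k hk hkm
      exact disjoint_left.1 (hUV m) hk (hkm ▸ hyV k)
    filter_upwards [hne] with k hk
    exact not_lt.1 fun hlt => hk _ hlt rfl
  have ha (k : ℕ) : q (x, p (s (N k), y k)) = a k := by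
    rw [← hay k, hpq, hqp]
  refine ⟨a, ?_, fun hfin => ?_⟩
  · have hlim := (hq.tendsto (x, p (x, x))).comp (tendsto_const_nhds.prodMk_nhds
      ((hp.tendsto (x, x)).comp ((hsx.comp hN).prodMk_nhds hyx)))
    rw [hqp] at hlim
    exact hlim.congr ha
  · obtain ⟨b, hb⟩ := hfin.bddAbove
    obtain ⟨k, hk⟩ := (hN.eventually_gt_atTop b).exists
    exact hk.not_ge (hb ⟨a k, mem_range_self k, haA k⟩)
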